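/- There exists a constant R ≥ 1 such that for all i ∈ Σ, all n ∈ ℕ and all a, b ∈ [0,1]², the singular values of the Jacobian matrices satisfy R⁻¹ ≤ α₁(D_a S_{i|n}) / α₁(D_b S_{i|n}) ≤ R and R⁻¹ ≤ α₂(D_a S_{i|n}) / α₂(D_b S_{i|n}) ≤ R. -/

import Mathlib

open MeasureTheory Filter Set

noncomputable section

namespace FFL

/-- The unit square `[0,1]² ⊆ ℝ²`. -/
def sq : Set (ℝ × ℝ) := Set.Icc (0:ℝ) 1 ×ˢ Set.Icc (0:ℝ) 1

/-- The Euclidean metric on `ℝ²`. -/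
def dE (a b : ℝ × ℝ) : ℝ := Real.sqrt ((a.1 - b.1) ^ 2 + (a.2 - b.2) ^ 2)

/-- Squared Frobenius norm of a 2×2 real matrix. -/
def frobSq (A : Matrix (Fin 2) (Fin 2) ℝ) : ℝ := ∑ i, ∑ j, (A i j) ^ 2

/-- The larger singular value `α₁` of a 2×2 real matrix, i.e. the larger positive square
root of the eigenvalues of `AᵀA`, via the standard closed formula. -/
def sv1 (A : Matrix (Fin 2) (Fin 2) ℝ) : ℝ :=
  Real.sqrt ((frobSq A + Real.sqrt ((frobSq A) ^ 2 - 4 * (A.det) ^ 2)) / 2)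

/-- The smaller singular value `α₂` of a 2×2 real matrix. -/
def sv2 (A : Matrix (Fin 2) (Fin 2) ℝ) : ℝ :=
  Real.sqrt ((frobSq A - Real.sqrt ((frobSq A) ^ 2 - 4 * (A.det) ^ 2)) / 2)

/-- The nonlinear, non-conformal iterated function systems of Falconer, Fraser and Lee:
maps `S i (a₁,a₂) = (f i a₁, g i (a₁,a₂))` on the unit square, where `f i`, `g i` are
`C^{1+α}` contractions (with partial derivatives `fx`, `gx`, `gy`) satisfying the
domination condition. -/
structure System (I : Type) [Fintype I] where
  f : I → ℝ → ℝ
  g : I → ℝ × ℝ → ℝ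
  fx : I → ℝ → ℝ
  gx : I → ℝ × ℝ → ℝ
  gy : I → ℝ × ℝ → ℝ
  /-- the index set has at least two elements -/
  card2 : 2 ≤ Fintype.card I
  /-- each `S i` maps the unit square into itself -/
  mapsTo : ∀ i, Set.MapsTo (fun a => (f i a.1, g i a)) sq sq
  /-- `fx i` is the derivative of `f i` on `[0,1]` -/
  hasDeriv_f : ∀ i, ∀ x ∈ Set.Icc (0:ℝ) 1,
    HasDerivWithinAt (f i) (fx i x) (Set.Icc (0:ℝ) 1) x
  /-- `(gx i, gy i)` is the (total) derivative of `g i` on the unit square -/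
  hasDeriv_g : ∀ i, ∀ a ∈ sq, HasFDerivWithinAt (g i)
      (gx i a • ContinuousLinearMap.fst ℝ ℝ ℝ + gy i a • ContinuousLinearMap.snd ℝ ℝ ℝ) sq a
  /-- the derivatives are `α`-Hölder for some `α > 0`, i.e. `f i`, `g i` are `C^{1+α}` -/
  holder : ∃ α > (0:ℝ), ∃ H > (0:ℝ), ∀ i,
      (∀ x ∈ Set.Icc (0:ℝ) 1, ∀ y ∈ Set.Icc (0:ℝ) 1, |fx i x - fx i y| ≤ H * |x - y| ^ α) ∧
      (∀ a ∈ sq, ∀ b ∈ sq, |gx i a - gx i b| ≤ H * dE a b ^ α) ∧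
      (∀ a ∈ sq, ∀ b ∈ sq, |gy i a - gy i b| ≤ H * dE a b ^ α)
  /-- the maps `f i`, `g i` (hence `S i`) are uniform contractions -/
  contracting : ∃ c, 0 ≤ c ∧ c < 1 ∧ ∀ i,
      (∀ x ∈ Set.Icc (0:ℝ) 1, ∀ y ∈ Set.Icc (0:ℝ) 1, |f i x - f i y| ≤ c * |x - y|) ∧
      (∀ a ∈ sq, ∀ b ∈ sq, |g i a - g i b| ≤ c * dE a b) ∧
      (∀ a ∈ sq, ∀ b ∈ sq, dE (f i a.1, g i a) (f i b.1, g i b) ≤ c * dE a b)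
  /-- the domination condition:
  `inf |f_{i,x}| > sup |g_{i,y}| ≥ inf |g_{i,y}| ≥ d > 0` -/
  domination : ∃ d > (0:ℝ), ∀ i,
      d ≤ sInf ((fun a => |gy i a|) '' sq) ∧
      sSup ((fun a => |gy i a|) '' sq) < sInf ((fun x => |fx i x|) '' Set.Icc (0:ℝ) 1)

variable {I : Type} [Fintype I]

/-- The map `S i`. -/
def S (T : System I) (i : I) (a : ℝ × ℝ) : ℝ × ℝ := (T.f i a.1, T.g i a)

/-- The composition `S_w = S_{i₁} ∘ ⋯ ∘ S_{i_n}` along a finite word `w = (i₁,…,i_n)`. -/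
def Sw (T : System I) : List I → ℝ × ℝ → ℝ × ℝ
  | [], a => a
  | i :: w, a => S T i (Sw T w a)

/-- The top-left entry `f_{w,x}(a)` of the (lower triangular) Jacobian `D_a S_w`,
via the chain rule. -/
def fxw (T : System I) : List I → ℝ × ℝ → ℝ
  | [], _ => 1
  | i :: w, a => T.fx i (Sw T w a).1 * fxw T w a

/-- The bottom-right entry `g_{w,y}(a)` of the Jacobian `D_a S_w`. -/
def gyw (T : System I) : List I → ℝ × ℝ → ℝ
  | [], _ => 1
  | i :: w, a => T.gy i (Sw T w a) * gyw T w a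

/-- The off-diagonal entry `g_{w,x}(a)` of the Jacobian `D_a S_w`. -/
def gxw (T : System I) : List I → ℝ × ℝ → ℝ
  | [], _ => 0
  | i :: w, a => T.gx i (Sw T w a) * fxw T w a + T.gy i (Sw T w a) * gxw T w a

/-- The Jacobian matrix `D_a S_w`. -/
def Dmat (T : System I) (w : List I) (a : ℝ × ℝ) : Matrix (Fin 2) (Fin 2) ℝ :=
  !![fxw T w a, 0; gxw T w a, gyw T w a]

/-- The larger singular value `α₁(D_a S_w)`. -/
def alpha1 (T : System I) (w : List I) (a : ℝ × ℝ) : ℝ := sv1 (Dmat T w a)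

/-- The smaller singular value `α₂(D_a S_w)`. -/
def alpha2 (T : System I) (w : List I) (a : ℝ × ℝ) : ℝ := sv2 (Dmat T w a)

/-- The restriction `i|n` of an infinite sequence to its first `n` symbols. -/
def word (ii : ℕ → I) (n : ℕ) : List I := List.ofFn (fun k : Fin n => ii k.1)

/-- The iterated left shift `σⁿ`. -/
def shiftn (ii : ℕ → I) (n : ℕ) : ℕ → I := fun k => ii (k + n)

/-- The left shift `σ` on `Σ = I^ℕ`. -/
def shift (ii : ℕ → I) : ℕ → I := fun k => ii (k + 1)

/-- The cylinder set `[w] ⊆ Σ` of a finite word `w`. -/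
def cyl (w : List I) : Set (ℕ → I) := {jj | ∀ k : Fin w.length, jj k.1 = w.get k}

/-- `F` is the attractor of the IFS: the (unique) nonempty compact subset of the unit
square with `F = ⋃ i, S i '' F`. -/
def IsAttractor (T : System I) (F : Set (ℝ × ℝ)) : Prop :=
  F.Nonempty ∧ IsCompact F ∧ F ⊆ sq ∧ F = ⋃ i, S T i '' F

/-- The strong separation condition: the sets `S i '' F` are pairwise disjoint. -/
def SSC (T : System I) (F : Set (ℝ × ℝ)) : Prop :=
  ∀ i j : I, i ≠ j → Disjoint (S T i '' F) (S T j '' F)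

/-- `Pi` is the canonical coding map `Π : Σ → [0,1]²`:
`Π(i)` is the unique point of `⋂ₙ S_{i|n}([0,1]²)`. -/
def IsCoding (T : System I) (Pi : (ℕ → I) → ℝ × ℝ) : Prop :=
  ∀ ii : ℕ → I, ∀ n : ℕ, Pi ii ∈ Sw T (word ii n) '' sq

/-- `m` is quasi-Bernoulli with constant `L`:
`L⁻¹ m[w] m[v] ≤ m[wv] ≤ L m[w] m[v]` for all finite words `w, v`. -/
def QuasiBernoulli [MeasurableSpace I] (m : Measure (ℕ → I)) (L : ℝ) : Prop :=
  0 < L ∧ ∀ w v : List I,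
    L⁻¹ * (m (cyl w)).toReal * (m (cyl v)).toReal ≤ (m (cyl (w ++ v))).toReal ∧
    (m (cyl (w ++ v))).toReal ≤ L * (m (cyl w)).toReal * (m (cyl v)).toReal

/-- The interval `Q₁(x,r) = [x - r/2, x + r/2]`. -/
def Q1 (x r : ℝ) : Set ℝ := Set.Icc (x - r / 2) (x + r / 2)

/-- The square `Q₂(a,r) = (a₁ - r/2, a₁ + r/2) × (a₂ - r/2, a₂ + r/2)`. -/
def Q2 (a : ℝ × ℝ) (r : ℝ) : Set (ℝ × ℝ) :=
  Set.Ioo (a.1 - r / 2) (a.1 + r / 2) ×ˢ Set.Ioo (a.2 - r / 2) (a.2 + r / 2)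

/-- The approximate square `B_n(a,r)`: points `b ∈ S_w([0,1]²)` with `|b₁ - a₁| ≤ r/2`. -/
def Bn (T : System I) (w : List I) (a : ℝ × ℝ) (r : ℝ) : Set (ℝ × ℝ) :=
  {b ∈ Sw T w '' sq | |b.1 - a.1| ≤ r / 2}

/-- The closed Euclidean ball in `ℝ²`. -/
def ballE (x : ℝ × ℝ) (r : ℝ) : Set (ℝ × ℝ) := {y | dE x y ≤ r}

/-- A measure on `ℝ` is exact dimensional with dimension `s` if for a.e. `x`,
`log ν(B(x,r)) / log r → s` as `r → 0⁺`. -/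
def ExactDim1 (ν : Measure ℝ) (s : ℝ) : Prop :=
  ∀ᵐ x ∂ν, Tendsto (fun r => Real.log (ν (Metric.closedBall x r)).toReal / Real.log r)
    (nhdsWithin 0 (Set.Ioi 0)) (nhds s)

/-- A measure on `ℝ²` is exact dimensional with dimension `s` (w.r.t. Euclidean balls). -/
def ExactDim2 (ν : Measure (ℝ × ℝ)) (s : ℝ) : Prop :=
  ∀ᵐ x ∂ν, Tendsto (fun r => Real.log (ν (ballE x r)).toReal / Real.log r)
    (nhdsWithin 0 (Set.Ioi 0)) (nhds s)

/-- `η = sup_{i ∈ I, a, b ∈ [0,1]²} |g_{i,y}(a)| / |f_{i,x}(b)|`. -/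
def eta (T : System I) : ℝ :=
  sSup {x : ℝ | ∃ i : I, ∃ a ∈ sq, ∃ b ∈ sq, x = |T.gy i a| / |T.fx i b.1|}

end FFL

open FFL

namespace FFL

lemma exists_dE_pow_le (α : ℝ) (hα : 0 < α) : ∃ M : ℝ, 0 < M ∧ ∀ a ∈ sq, ∀ b ∈ sq,
    dE a b ^ α ≤ M := by
  refine ⟨2 ^ α, by positivity, fun a ha b hb => ?_⟩
  obtain ⟨⟨h1, h2⟩, h3, h4⟩ := ha
  obtain ⟨⟨h5, h6⟩, h7, h8⟩ := hb
  refine Real.rpow_le_rpow (Real.sqrt_nonneg _) ?_ hα.le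
  refine Real.sqrt_le_iff.2 ⟨by norm_num, ?_⟩
  nlinarith

lemma abs_fst_sub_le_dE (a b : ℝ × ℝ) : |a.1 - b.1| ≤ dE a b :=
  Real.abs_le_sqrt (by nlinarith [sq_nonneg (a.2 - b.2)])

lemma zero_mem_sq : (0 : ℝ × ℝ) ∈ sq := by
  constructor <;> norm_num

lemma abs_le_of_holder {φ : ℝ × ℝ → ℝ} {α H M : ℝ} (hH : 0 < H)
    (hM : ∀ a ∈ sq, ∀ b ∈ sq, dE a b ^ α ≤ M)
    (h : ∀ a ∈ sq, ∀ b ∈ sq, |φ a - φ b| ≤ H * dE a b ^ α) {a : ℝ × ℝ} (ha : a ∈ sq) :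
    |φ a| ≤ |φ 0| + H * M := by
  have h1 := h a ha 0 zero_mem_sq
  have h2 := mul_le_mul_of_nonneg_left (hM a ha 0 zero_mem_sq) hH.le
  linarith [abs_sub_abs_le_abs_sub (φ a) (φ 0)]

lemma sv_comparable_diagonal {f g h K : ℝ} (hf : f ≠ 0) (hgf : |g| ≤ |f|) (hh : |h| ≤ K * |f|) :
    (|f| ≤ (2 + K ^ 2) * sv1 !![f, 0; h, g] ∧ sv1 !![f, 0; h, g] ≤ (2 + K ^ 2) * |f|) ∧
    (|g| ≤ (2 + K ^ 2) * sv2 !![f, 0; h, g] ∧ sv2 !![f, 0; h, g] ≤ (2 + K ^ 2) * |g|) := by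
  set C := 2 + K ^ 2 with hC
  have hC2 : 2 ≤ C := by nlinarith [sq_nonneg K]
  have hg2 : g ^ 2 ≤ f ^ 2 := sq_le_sq.2 hgf
  have hh2 : h ^ 2 ≤ K ^ 2 * f ^ 2 := by
    have := pow_le_pow_left₀ (abs_nonneg h) hh 2
    rwa [mul_pow, sq_abs, sq_abs] at this
  have hf2 : 0 < f ^ 2 := by positivity
  have hfrob : frobSq !![f, 0; h, g] = f ^ 2 + h ^ 2 + g ^ 2 := by
    simp [frobSq, Fin.sum_univ_two]; ring
  have hdet : (!![f, 0; h, g] : Matrix (Fin 2) (Fin 2) ℝ).det = f * g := by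
    simp [Matrix.det_fin_two]
  unfold sv1 sv2
  rw [hfrob, hdet]
  set F := f ^ 2 + h ^ 2 + g ^ 2 with hF
  have hFf : f ^ 2 ≤ F := by nlinarith [sq_nonneg h, sq_nonneg g]
  have hFC : F ≤ C * f ^ 2 := by rw [hC]; nlinarith
  have hD : 0 ≤ F ^ 2 - 4 * (f * g) ^ 2 := by
    have h1 : 0 ≤ F - 2 * (f * g) := by nlinarith [sq_nonneg (f - g), sq_nonneg h]
    have h2 : 0 ≤ F + 2 * (f * g) := by nlinarith [sq_nonneg (f + g), sq_nonneg h]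
    nlinarith [mul_nonneg h1 h2]
  set s := Real.sqrt (F ^ 2 - 4 * (f * g) ^ 2) with hs
  have hs0 : 0 ≤ s := Real.sqrt_nonneg _
  have hsF : s ≤ F := by
    refine Real.sqrt_le_iff.2 ⟨by linarith, ?_⟩
    nlinarith [sq_nonneg (f * g)]
  have hprod : (F - s) * (F + s) = 4 * f ^ 2 * g ^ 2 := by
    have := Real.sq_sqrt hD
    rw [← hs] at this
    nlinarith
  have hup : F - s ≤ 4 * g ^ 2 := by
    refine le_of_mul_le_mul_right ?_ hf2
    have := mul_le_mul_of_nonneg_left (show f ^ 2 ≤ F + s by linarith) (sub_nonneg.2 hsF)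
    nlinarith
  have hlo : 2 * g ^ 2 ≤ C * (F - s) := by
    refine le_of_mul_le_mul_right ?_ hf2
    have := mul_le_mul_of_nonneg_left (show F + s ≤ 2 * (C * f ^ 2) by linarith)
      (sub_nonneg.2 hsF)
    nlinarith
  have key : ∀ x y : ℝ, 0 ≤ y → x ^ 2 ≤ C * y → y ≤ C * x ^ 2 →
      |x| ≤ C * Real.sqrt y ∧ Real.sqrt y ≤ C * |x| := by
    intro x y hy h1 h2
    constructor
    · refine abs_le_of_sq_le_sq ?_ (by positivity)
      rw [mul_pow, Real.sq_sqrt hy]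
      nlinarith [mul_nonneg (show 0 ≤ C - 1 by linarith) (mul_nonneg (show 0 ≤ C by linarith) hy)]
    · refine Real.sqrt_le_iff.2 ⟨by positivity, ?_⟩
      rw [mul_pow, sq_abs]
      nlinarith [mul_nonneg (show 0 ≤ C - 1 by linarith)
        (mul_nonneg (show 0 ≤ C by linarith) (sq_nonneg x))]
  refine ⟨key f _ (by linarith) ?_ ?_, key g _ (by linarith) ?_ ?_⟩
  · nlinarith
  · nlinarith
  · linarith
  · nlinarith [sq_nonneg g]

variable {I : Type} [Fintype I] (T : System I)

lemma Sw_mem_sq (w : List I) {a : ℝ × ℝ} (ha : a ∈ sq) : Sw T w a ∈ sq := by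
  induction w with
  | nil => exact ha
  | cons i w ih => exact T.mapsTo i ih

lemma dE_Sw_le {c : ℝ} (hc : 0 ≤ c)
    (h : ∀ i, ∀ a ∈ sq, ∀ b ∈ sq, dE (S T i a) (S T i b) ≤ c * dE a b)
    (w : List I) {a b : ℝ × ℝ} (ha : a ∈ sq) (hb : b ∈ sq) :
    dE (Sw T w a) (Sw T w b) ≤ c ^ w.length * dE a b := by
  induction w with
  | nil => simp [Sw]
  | cons i w ih =>
    refine (h i _ (Sw_mem_sq T w ha) _ (Sw_mem_sq T w hb)).trans ?_
    rw [List.length_cons, pow_succ', mul_assoc]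
    exact mul_le_mul_of_nonneg_left ih hc

/-- Bounded distortion for products of a Hölder function, bounded away from `0`, along orbits. -/
lemma exists_distortion {φ : I → ℝ × ℝ → ℝ} {P : List I → ℝ × ℝ → ℝ}
    (hnil : ∀ a, P [] a = 1) (hcons : ∀ i w a, P (i :: w) a = φ i (Sw T w a) * P w a)
    {d α H : ℝ} (hd : 0 < d) (hα : 0 < α) (hH : 0 < H)
    (hφd : ∀ i, ∀ a ∈ sq, d ≤ |φ i a|)
    (hφ : ∀ i, ∀ a ∈ sq, ∀ b ∈ sq, |φ i a - φ i b| ≤ H * dE a b ^ α) :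
    ∃ R : ℝ, 1 ≤ R ∧ ∀ w, ∀ a ∈ sq, ∀ b ∈ sq, |P w a| ≤ R * |P w b| := by
  obtain ⟨c, hc0, hc1, hc⟩ := T.contracting
  obtain ⟨M, hM0, hM⟩ := exists_dE_pow_le α hα
  have hq0 : 0 ≤ c ^ α := Real.rpow_nonneg hc0 α
  have hq1 : c ^ α < 1 := Real.rpow_lt_one hc0 hc1 hα
  have hpart : ∀ w, ∀ a ∈ sq, ∀ b ∈ sq,
      |P w a| ≤ Real.exp (H / d * M * ∑ k ∈ Finset.range w.length, (c ^ α) ^ k) * |P w b| := by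
    intro w a ha b hb
    induction w with
    | nil => simp [hnil]
    | cons i w ih =>
      have ha' := Sw_mem_sq T w ha
      have hb' := Sw_mem_sq T w hb
      have hdist : dE (Sw T w a) (Sw T w b) ^ α ≤ (c ^ α) ^ w.length * M := by
        refine (Real.rpow_le_rpow (Real.sqrt_nonneg _)
          (dE_Sw_le T hc0 (fun i => (hc i).2.2) w ha hb) hα.le).trans ?_
        rw [Real.mul_rpow (y := dE a b) (by positivity) (Real.sqrt_nonneg _),
          ← Real.rpow_pow_comm hc0]
        exact mul_le_mul_of_nonneg_left (hM a ha b hb) (by positivity)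
      have hstep : |φ i (Sw T w a)| ≤
          Real.exp (H / d * M * (c ^ α) ^ w.length) * |φ i (Sw T w b)| := by
        set t := (c ^ α) ^ w.length * M with ht
        have ht0 : 0 ≤ t := by positivity
        have h1 : |φ i (Sw T w a)| ≤ |φ i (Sw T w b)| + H * t := by
          have := hφ i _ ha' _ hb'
          have := mul_le_mul_of_nonneg_left hdist hH.le
          linarith [abs_sub_abs_le_abs_sub (φ i (Sw T w a)) (φ i (Sw T w b))]
        have h2 : H * t ≤ H / d * t * |φ i (Sw T w b)| := by
          have := mul_le_mul_of_nonneg_left (hφd i _ hb') (show 0 ≤ H / d * t by positivity)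
          refine le_trans (le_of_eq ?_) this
          field_simp
        have h3 := mul_le_mul_of_nonneg_right (Real.add_one_le_exp (H / d * t))
          (abs_nonneg (φ i (Sw T w b)))
        rw [show H / d * M * (c ^ α) ^ w.length = H / d * t by rw [ht]; ring]
        linarith
      rw [hcons, hcons, abs_mul, abs_mul, List.length_cons, Finset.sum_range_succ, mul_add,
        Real.exp_add]
      refine (mul_le_mul hstep ih (abs_nonneg _) (by positivity)).trans (le_of_eq ?_)
      ring
  refine ⟨Real.exp (H / d * M * (1 - c ^ α)⁻¹), ?_, fun w a ha b hb => ?_⟩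
  · exact Real.one_le_exp (mul_nonneg (by positivity) (inv_nonneg.2 (by linarith)))
  · refine (hpart w a ha b hb).trans (mul_le_mul_of_nonneg_right ?_ (abs_nonneg _))
    refine Real.exp_le_exp.2 (mul_le_mul_of_nonneg_left ?_ (by positivity))
    rw [← tsum_geometric_of_lt_one hq0 hq1]
    exact (summable_geometric_of_lt_one hq0 hq1).sum_le_tsum _ (fun k _ => by positivity)

lemma exists_uniform_domination : ∃ d > (0 : ℝ), ∃ η : ℝ, 0 ≤ η ∧ η < 1 ∧ ∀ i, ∀ a ∈ sq,
    d ≤ |T.gy i a| ∧ d ≤ |T.fx i a.1| ∧ |T.gy i a| ≤ η * |T.fx i a.1| := by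
  obtain ⟨d, hd, h⟩ := T.domination
  obtain ⟨α, hα, H, hH, hhol⟩ := T.holder
  obtain ⟨M, -, hM⟩ := exists_dE_pow_le α hα
  set s : I → ℝ := fun i => sSup ((fun a => |T.gy i a|) '' sq) with hs
  set m : I → ℝ := fun i => sInf ((fun x => |T.fx i x|) '' Set.Icc (0:ℝ) 1) with hm
  have hlow : ∀ i, ∀ a ∈ sq, d ≤ |T.gy i a| := fun i a ha => (h i).1.trans
    (csInf_le ⟨0, by rintro _ ⟨x, -, rfl⟩; exact abs_nonneg _⟩ ⟨a, ha, rfl⟩)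
  have hup : ∀ i, ∀ a ∈ sq, |T.gy i a| ≤ s i := fun i a ha =>
    le_csSup ⟨|T.gy i 0| + H * M, by
      rintro _ ⟨x, hx, rfl⟩
      exact abs_le_of_holder hH hM (hhol i).2.2 hx⟩ ⟨a, ha, rfl⟩
  have hfx : ∀ i, ∀ a ∈ sq, m i ≤ |T.fx i a.1| := fun i a ha =>
    csInf_le ⟨0, by rintro _ ⟨x, -, rfl⟩; exact abs_nonneg _⟩ ⟨a.1, ha.1, rfl⟩
  have hds : ∀ i, d ≤ s i := fun i => (hlow i 0 zero_mem_sq).trans (hup i 0 zero_mem_sq)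
  have hsm : ∀ i, s i < m i := fun i => (h i).2
  have : Nonempty I := Fintype.card_pos_iff.1 (by have := T.card2; omega)
  obtain ⟨j, hj⟩ := Finite.exists_max (fun i => s i / m i)
  have hm0 : ∀ i, 0 < m i := fun i => by linarith [hds i, hsm i]
  have hs0 : ∀ i, 0 < s i := fun i => by linarith [hds i]
  refine ⟨d, hd, s j / m j, (div_pos (hs0 j) (hm0 j)).le, (div_lt_one (hm0 j)).2 (hsm j),
    fun i a ha => ⟨hlow i a ha, ?_, ?_⟩⟩
  · linarith [hds i, hsm i, hfx i a ha]
  · have h1 := (div_le_iff₀ (hm0 i)).1 (hj i)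
    have h2 := mul_le_mul_of_nonneg_left (hfx i a ha) (div_pos (hs0 j) (hm0 j)).le
    linarith [hup i a ha]

lemma exists_jacobian_bounds : ∃ K : ℝ, ∀ w, ∀ a ∈ sq, 0 < |fxw T w a| ∧ 0 < |gyw T w a| ∧
    |gyw T w a| ≤ |fxw T w a| ∧ |gxw T w a| ≤ K * |fxw T w a| := by
  obtain ⟨d, hd, η, hη0, hη1, h⟩ := exists_uniform_domination T
  obtain ⟨α, hα, H, hH, hhol⟩ := T.holder
  obtain ⟨M, hM0, hM⟩ := exists_dE_pow_le α hα
  set B : ℝ := ∑ i, |T.gx i 0| + H * M with hB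
  have hB0 : 0 ≤ B := by positivity
  have hgx : ∀ i, ∀ a ∈ sq, |T.gx i a| ≤ B := fun i a ha => by
    have h1 := abs_le_of_holder hH hM (hhol i).2.1 ha
    have h2 := Finset.single_le_sum (f := fun i => |T.gx i 0|) (fun i _ => abs_nonneg _)
      (Finset.mem_univ i)
    linarith
  have hη : 0 < 1 - η := by linarith
  refine ⟨B / (d * (1 - η)), fun w a ha => ?_⟩
  set K := B / (d * (1 - η)) with hK
  have hK0 : 0 ≤ K := by positivity
  have hBK : B = K * (1 - η) * d := by rw [hK]; field_simp
  induction w with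
  | nil => simpa [fxw, gyw, gxw] using hK0
  | cons i w ih =>
    obtain ⟨h1, h2, h3, h4⟩ := ih
    have hmem := Sw_mem_sq T w ha
    obtain ⟨k1, k2, k3⟩ := h i _ hmem
    have k4 := hgx i _ hmem
    simp only [fxw, gyw, gxw]
    set p := |T.fx i (Sw T w a).1| with hp
    rw [abs_mul, abs_mul, ← hp]
    refine ⟨mul_pos (by linarith) h1, mul_pos (by linarith) h2,
      mul_le_mul (by nlinarith) h3 h2.le (by linarith), ?_⟩
    refine (abs_add_le _ _).trans ?_
    rw [abs_mul, abs_mul]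
    have e1 : |T.gx i (Sw T w a)| ≤ K * (1 - η) * p := by
      rw [hBK] at k4
      exact k4.trans (mul_le_mul_of_nonneg_left k2 (by positivity))
    have e2 := mul_le_mul_of_nonneg_right e1 h1.le
    have e3 := mul_le_mul k3 h4 (abs_nonneg _) (by positivity)
    calc _ ≤ K * (1 - η) * p * |fxw T w a| + η * p * (K * |fxw T w a|) := add_le_add e2 e3
      _ = _ := by ring

lemma inv_le_div_and_div_le {x y R : ℝ} (hy : 0 < y) (hR : 0 < R)
    (h1 : x ≤ R * y) (h2 : y ≤ R * x) : R⁻¹ ≤ x / y ∧ x / y ≤ R := by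
  refine ⟨?_, (div_le_iff₀ hy).2 h1⟩
  rw [le_div_iff₀ hy, inv_mul_le_iff₀ hR]
  exact h2

/-- Two-sided comparability with a quantity of bounded distortion gives bounded distortion. -/
lemma distortion_of_comparable {u v : ℝ × ℝ → ℝ} {C R₀ R : ℝ} (hC : 0 < C) (hR₀ : 1 ≤ R₀)
    (hR : C ^ 2 * R₀ ≤ R) (hv : ∀ a ∈ sq, 0 < v a)
    (huv : ∀ a ∈ sq, v a ≤ C * u a ∧ u a ≤ C * v a)
    (hdist : ∀ a ∈ sq, ∀ b ∈ sq, v a ≤ R₀ * v b) {a b : ℝ × ℝ} (ha : a ∈ sq) (hb : b ∈ sq) :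
    R⁻¹ ≤ u a / u b ∧ u a / u b ≤ R := by
  have hu : ∀ a ∈ sq, 0 < u a := fun a ha =>
    pos_of_mul_pos_right ((hv a ha).trans_le (huv a ha).1) hC.le
  have hle : ∀ a ∈ sq, ∀ b ∈ sq, u a ≤ R * u b := fun a ha b hb => by
    calc u a ≤ C * v a := (huv a ha).2
      _ ≤ C * (R₀ * (C * u b)) := by
        refine mul_le_mul_of_nonneg_left ((hdist a ha b hb).trans ?_) hC.le
        exact mul_le_mul_of_nonneg_left (huv b hb).1 (by linarith)
      _ = C ^ 2 * R₀ * u b := by ring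
      _ ≤ R * u b := mul_le_mul_of_nonneg_right hR (hu b hb).le
  have hRpos : 0 < R := lt_of_lt_of_le (by positivity) hR
  exact inv_le_div_and_div_le (hu b hb) hRpos (hle a ha b hb) (hle b hb a ha)

end FFL

/-- bounded distortion for the singular values of the Jacobians. -/
theorem stmt4 {I : Type} [Fintype I] (T : System I) :
    ∃ R : ℝ, 1 ≤ R ∧ ∀ (ii : ℕ → I) (n : ℕ), ∀ a ∈ sq, ∀ b ∈ sq,
      (R⁻¹ ≤ alpha1 T (word ii n) a / alpha1 T (word ii n) b ∧
        alpha1 T (word ii n) a / alpha1 T (word ii n) b ≤ R) ∧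
      (R⁻¹ ≤ alpha2 T (word ii n) a / alpha2 T (word ii n) b ∧
        alpha2 T (word ii n) a / alpha2 T (word ii n) b ≤ R) := by
  obtain ⟨d, hd, η, -, -, hdom⟩ := exists_uniform_domination T
  obtain ⟨α, hα, H, hH, hhol⟩ := T.holder
  obtain ⟨K, hK⟩ := exists_jacobian_bounds T
  obtain ⟨R₁, hR₁, hf⟩ := exists_distortion T (φ := fun i a => T.fx i a.1) (P := fxw T)
    (fun _ => rfl) (fun _ _ _ => rfl) hd hα hH (fun i a ha => (hdom i a ha).2.1)
    (fun i a ha b hb => ((hhol i).1 _ ha.1 _ hb.1).trans <|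
      mul_le_mul_of_nonneg_left
        (Real.rpow_le_rpow (abs_nonneg _) (abs_fst_sub_le_dE a b) hα.le) hH.le)
  obtain ⟨R₂, hR₂, hg⟩ := exists_distortion T (φ := T.gy) (P := gyw T)
    (fun _ => rfl) (fun _ _ _ => rfl) hd hα hH (fun i a ha => (hdom i a ha).1)
    (fun i => (hhol i).2.2)
  have hC : 1 ≤ 2 + K ^ 2 := by nlinarith [sq_nonneg K]
  have hC2 : 1 ≤ (2 + K ^ 2) ^ 2 := one_le_pow₀ hC
  have hsv : ∀ w, ∀ a ∈ sq, _ := fun w a ha =>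
    sv_comparable_diagonal (abs_pos.1 (hK w a ha).1) (hK w a ha).2.2.1 (hK w a ha).2.2.2
  refine ⟨(2 + K ^ 2) ^ 2 * (R₁ * R₂), ?_, fun ii n a ha b hb => ⟨?_, ?_⟩⟩
  · exact one_le_mul_of_one_le_of_one_le hC2 (one_le_mul_of_one_le_of_one_le hR₁ hR₂)
  · exact distortion_of_comparable (by linarith) hR₁
      (mul_le_mul_of_nonneg_left (le_mul_of_one_le_right (by linarith) hR₂) (by positivity))
      (fun a ha => (hK _ a ha).1) (fun a ha => (hsv (word ii n) a ha).1) (hf _) ha hb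
  · exact distortion_of_comparable (by linarith) hR₂
      (mul_le_mul_of_nonneg_left (le_mul_of_one_le_left (by linarith) hR₁) (by positivity))
      (fun a ha => (hK _ a ha).2.1) (fun a ha => (hsv (word ii n) a ha).2) (hg _) ha hb
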